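/- arXiv:2003.03467 — 4 statements merged into one kernel-verified Lean document; each statement's English description precedes it below -/
import Mathlib

section
/- Let R be a ring, G a subgroup of the group of units of R, and 𝓛, 𝓒, 𝓝 subsets of R each closed under conjugation by elements of G. Assume that for every L ∈ 𝓛 there is a unique C ∈ 𝓒 with L − C ∈ 𝓝. Let X be any type and let I : R → X satisfy I(u⁻¹·N·u) = I(N) for every N ∈ 𝓝 and u ∈ G. Then for every L ∈ 𝓛, u ∈ G and C, C' ∈ 𝓒 with L − C ∈ 𝓝 and u⁻¹·L·u − C' ∈ 𝓝, one has I(u⁻¹·L·u − C') = I(L − C); that is, every conjugation-invariant of 𝓝 induces a conjugation-invariant of 𝓛 via the unique complement. -/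
theorem invariants_of_N_are_invariants_of_L
    {R : Type*} [Ring R] (G : Subgroup Rˣ) (L' C' N' : Set R)
    (hL : ∀ A ∈ L', ∀ u ∈ G, (↑u⁻¹ * A * ↑u : R) ∈ L')
    (hC : ∀ A ∈ C', ∀ u ∈ G, (↑u⁻¹ * A * ↑u : R) ∈ C')
    (hN : ∀ A ∈ N', ∀ u ∈ G, (↑u⁻¹ * A * ↑u : R) ∈ N')
    (huniq : ∀ L ∈ L', ∃! C, C ∈ C' ∧ L - C ∈ N')
    {X : Type*} (I : R → X)
    (hI : ∀ N ∈ N', ∀ u ∈ G, I (↑u⁻¹ * N * ↑u : R) = I N) :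
    ∀ L ∈ L', ∀ u ∈ G, ∀ C ∈ C', ∀ C'' ∈ C',
      L - C ∈ N' → (↑u⁻¹ * L * ↑u : R) - C'' ∈ N' →
      I ((↑u⁻¹ * L * ↑u : R) - C'') = I (L - C) := by
  intro L hLmem u hu C hCmem C'' hC'' hLC hLC''
  have conj_sub : (↑u⁻¹ * L * ↑u : R) - ↑u⁻¹ * C * ↑u = ↑u⁻¹ * (L - C) * ↑u := by
    rw [mul_sub, sub_mul]
  have hC''_eq : C'' = ↑u⁻¹ * C * ↑u :=
    (huniq _ (hL L hLmem u hu)).unique ⟨hC'', hLC''⟩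
      ⟨hC C hCmem u hu, conj_sub ▸ hN _ hLC u hu⟩
  rw [hC''_eq, conj_sub, hI _ hLC u hu]
end

section
/- Let a, b, c, a', b', c', g : ℝ² → ℝ be smooth, and define operators L u = ∂_x∂_y u + a·∂_x u + b·∂_y u + c·u and L' u = ∂_x∂_y u + a'·∂_x u + b'·∂_y u + c'·u on smooth u : ℝ² → ℝ. If L' u = e^{−g}·L(e^{g}·u) for every smooth u, then the Laplace invariants agree: c' − ∂_x a' − a'·b' = c − ∂_x a − a·b and c' − ∂_y b' − a'·b' = c − ∂_y b − a·b (as functions on ℝ²). -/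
noncomputable def dx (f : (Fin 2 → ℝ) → ℝ) : (Fin 2 → ℝ) → ℝ :=
  fun p => fderiv ℝ f p (Pi.single 0 1)

noncomputable def dy (f : (Fin 2 → ℝ) → ℝ) : (Fin 2 → ℝ) → ℝ :=
  fun p => fderiv ℝ f p (Pi.single 1 1)

section PartialDerivatives

variable {f g u : (Fin 2 → ℝ) → ℝ}

theorem dx_add (hf : Differentiable ℝ f) (hg : Differentiable ℝ g) (p : Fin 2 → ℝ) :
    dx (fun y => f y + g y) p = dx f p + dx g p := by
  simp [dx, fderiv_fun_add (hf p) (hg p)]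

theorem dy_add (hf : Differentiable ℝ f) (hg : Differentiable ℝ g) (p : Fin 2 → ℝ) :
    dy (fun y => f y + g y) p = dy f p + dy g p := by
  simp [dy, fderiv_fun_add (hf p) (hg p)]

theorem dx_mul (hf : Differentiable ℝ f) (hg : Differentiable ℝ g) (p : Fin 2 → ℝ) :
    dx (fun y => f y * g y) p = f p * dx g p + g p * dx f p := by
  simp [dx, fderiv_fun_mul (hf p) (hg p)]

theorem dy_mul (hf : Differentiable ℝ f) (hg : Differentiable ℝ g) (p : Fin 2 → ℝ) :
    dy (fun y => f y * g y) p = f p * dy g p + g p * dy f p := by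
  simp [dy, fderiv_fun_mul (hf p) (hg p)]

theorem dx_exp (hf : Differentiable ℝ f) (p : Fin 2 → ℝ) :
    dx (fun y => Real.exp (f y)) p = Real.exp (f p) * dx f p := by
  simp [dx, fderiv_exp (hf p)]

theorem dy_exp (hf : Differentiable ℝ f) (p : Fin 2 → ℝ) :
    dy (fun y => Real.exp (f y)) p = Real.exp (f p) * dy f p := by
  simp [dy, fderiv_exp (hf p)]

theorem dx_const (r : ℝ) : dx (fun _ => r) = fun _ => 0 := by
  funext p; simp [dx]

theorem dy_const (r : ℝ) : dy (fun _ => r) = fun _ => 0 := by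
  funext p; simp [dy]

theorem fderiv_coord (i : Fin 2) (p : Fin 2 → ℝ) :
    fderiv ℝ (fun q : Fin 2 → ℝ => q i) p = ContinuousLinearMap.proj i :=
  (ContinuousLinearMap.proj (R := ℝ) (φ := fun _ : Fin 2 => ℝ) i).fderiv

theorem dx_coord_zero : dx (fun p => p 0) = fun _ => 1 := by
  funext p; simp [dx, fderiv_coord]

theorem dx_coord_one : dx (fun p => p 1) = fun _ => 0 := by
  funext p; simp [dx, fderiv_coord]

theorem dy_coord_zero : dy (fun p => p 0) = fun _ => 0 := by
  funext p; simp [dy, fderiv_coord]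

theorem dy_coord_one : dy (fun p => p 1) = fun _ => 1 := by
  funext p; simp [dy, fderiv_coord]

theorem differentiable_dx (hf : ContDiff ℝ 2 f) : Differentiable ℝ (dx f) :=
  ((hf.fderiv_right (m := 1) (by norm_num)).clm_apply contDiff_const).differentiable (by norm_num)

theorem differentiable_dy (hf : ContDiff ℝ 2 f) : Differentiable ℝ (dy f) :=
  ((hf.fderiv_right (m := 1) (by norm_num)).clm_apply contDiff_const).differentiable (by norm_num)

theorem dx_dy_comm (hf : ContDiff ℝ 2 f) (p : Fin 2 → ℝ) : dx (dy f) p = dy (dx f) p := by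
  have hd : DifferentiableAt ℝ (fderiv ℝ f) p :=
    (hf.fderiv_right (m := 1) (by norm_num)).differentiable (by norm_num) p
  have hs : IsSymmSndFDerivAt ℝ f p := hf.contDiffAt.isSymmSndFDerivAt (by simp)
  have key (v w : Fin 2 → ℝ) :
      fderiv ℝ (fun q => fderiv ℝ f q v) p w = fderiv ℝ (fderiv ℝ f) p w v := by
    simp [fderiv_clm_apply hd (differentiableAt_const v)]
  exact (key _ _).trans ((hs _ _).trans (key _ _).symm)

theorem dx_dy_exp_mul (hg : ContDiff ℝ 2 g) (hu : ContDiff ℝ 2 u) (p : Fin 2 → ℝ) :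
    dx (dy (fun y => Real.exp (g y) * u y)) p =
      Real.exp (g p) * (dx (dy u) p + dy g p * dx u p + dx g p * dy u p
        + (dx (dy g) p + dx g p * dy g p) * u p) := by
  have hgd := hg.differentiable (by norm_num)
  have hud := hu.differentiable (by norm_num)
  have hdy : dy (fun y => Real.exp (g y) * u y) =
      fun y => Real.exp (g y) * (dy u y + u y * dy g y) := by
    funext y
    rw [dy_mul hgd.exp hud, dy_exp hgd]
    ring
  have hmul : Differentiable ℝ (fun y => u y * dy g y) := hud.mul (differentiable_dy hg)
  have hadd : Differentiable ℝ (fun y => dy u y + u y * dy g y) := (differentiable_dy hu).add hmul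
  rw [hdy, dx_mul hgd.exp hadd, dx_exp hgd,
    dx_add (differentiable_dy hu) hmul, dx_mul hud (differentiable_dy hg)]
  ring

end PartialDerivatives

theorem laplace_invariants_are_gauge_invariant
    (a b c a' b' c' g : (Fin 2 → ℝ) → ℝ)
    (ha : ContDiff ℝ (⊤ : ℕ∞) a) (hb : ContDiff ℝ (⊤ : ℕ∞) b) (hc : ContDiff ℝ (⊤ : ℕ∞) c)
    (ha' : ContDiff ℝ (⊤ : ℕ∞) a') (hb' : ContDiff ℝ (⊤ : ℕ∞) b') (hc' : ContDiff ℝ (⊤ : ℕ∞) c')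
    (hg : ContDiff ℝ (⊤ : ℕ∞) g)
    (hgauge : ∀ u : (Fin 2 → ℝ) → ℝ, ContDiff ℝ (⊤ : ℕ∞) u → ∀ x,
      dx (dy u) x + a' x * dx u x + b' x * dy u x + c' x * u x =
      Real.exp (-(g x)) *
        (dx (dy (fun y => Real.exp (g y) * u y)) x
          + a x * dx (fun y => Real.exp (g y) * u y) x
          + b x * dy (fun y => Real.exp (g y) * u y) x
          + c x * (Real.exp (g x) * u x))) :
    (∀ x, c' x - dx a' x - a' x * b' x = c x - dx a x - a x * b x) ∧
    (∀ x, c' x - dy b' x - a' x * b' x = c x - dy b x - a x * b x) := by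
  have hg2 : ContDiff ℝ 2 g := hg.of_le (WithTop.coe_le_coe.2 le_top)
  have hgd := hg2.differentiable (by norm_num)
  have expand (u : (Fin 2 → ℝ) → ℝ) (hu : ContDiff ℝ (⊤ : ℕ∞) u) (x : Fin 2 → ℝ) :
      dx (dy u) x + a' x * dx u x + b' x * dy u x + c' x * u x =
        dx (dy u) x + (a x + dy g x) * dx u x + (b x + dx g x) * dy u x
          + (c x + dx (dy g) x + dx g x * dy g x + a x * dx g x + b x * dy g x) * u x := by
    have hu2 : ContDiff ℝ 2 u := hu.of_le (WithTop.coe_le_coe.2 le_top)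
    have hud := hu2.differentiable (by norm_num)
    have he : Real.exp (-(g x)) * Real.exp (g x) = 1 := by rw [← Real.exp_add]; simp
    rw [hgauge u hu x, dx_dy_exp_mul hg2 hu2, dx_mul hgd.exp hud, dy_mul hgd.exp hud,
      dx_exp hgd, dy_exp hgd]
    linear_combination (dx (dy u) x + (a x + dy g x) * dx u x + (b x + dx g x) * dy u x
      + (c x + dx (dy g) x + dx g x * dy g x + a x * dx g x + b x * dy g x) * u x) * he
  have hc_eq (x) :
      c' x = c x + dx (dy g) x + dx g x * dy g x + a x * dx g x + b x * dy g x := by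
    simpa [dx_const, dy_const] using expand (fun _ => 1) contDiff_const x
  have ha_eq : a' = fun x => a x + dy g x := by
    funext x
    have h := expand (fun p => p 0) (contDiff_apply ℝ ℝ 0) x
    simp only [dx_coord_zero, dy_coord_zero, dx_const] at h
    linear_combination h - x 0 * hc_eq x
  have hb_eq : b' = fun x => b x + dx g x := by
    funext x
    have h := expand (fun p => p 1) (contDiff_apply ℝ ℝ 1) x
    simp only [dx_coord_one, dy_coord_one, dx_const] at h
    linear_combination h - x 1 * hc_eq x
  have had := ha.differentiable (by simp)
  have hbd := hb.differentiable (by simp)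
  refine ⟨fun x => ?_, fun x => ?_⟩
  · rw [hc_eq, ha_eq, hb_eq, dx_add had (differentiable_dy hg2)]
    ring
  · rw [hc_eq, ha_eq, hb_eq, dy_add hbd (differentiable_dx hg2), dx_dy_comm hg2]
    ring
end

section
/- Let a, b, c, a', b', c' : ℝ² → ℝ be smooth and suppose the Laplace invariants agree pointwise: c' − ∂_x a' − a'·b' = c − ∂_x a − a·b and c' − ∂_y b' − a'·b' = c − ∂_y b − a·b. Then there exists a smooth g : ℝ² → ℝ such that for every smooth u : ℝ² → ℝ, ∂_x∂_y u + a'·∂_x u + b'·∂_y u + c'·u = e^{−g}·( ∂_x∂_y(e^{g}u) + a·∂_x(e^{g}u) + b·∂_y(e^{g}u) + c·e^{g}u ). In other words, {h, k} is a complete set of invariants for second-order hyperbolic operators on ℝ². -/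
/-- Poincaré lemma in the plane: a smooth closed `1`-form has a smooth primitive. -/
theorem exists_contDiff_dx_eq_dy_eq {P Q : (Fin 2 → ℝ) → ℝ}
    (hP : ContDiff ℝ (⊤ : ℕ∞) P) (hQ : ContDiff ℝ (⊤ : ℕ∞) Q) (hPQ : ∀ x, dy P x = dx Q x) :
    ∃ g : (Fin 2 → ℝ) → ℝ, ContDiff ℝ (⊤ : ℕ∞) g ∧ dx g = P ∧ dy g = Q := by
  let π (i : Fin 2) : (Fin 2 → ℝ) →L[ℝ] ℝ := ContinuousLinearMap.proj i
  let ω (x : Fin 2 → ℝ) : (Fin 2 → ℝ) →L[ℝ] ℝ := P x • π 0 + Q x • π 1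
  have hω : ContDiff ℝ (⊤ : ℕ∞) ω :=
    (hP.smul contDiff_const).add (hQ.smul contDiff_const)
  have hPd : Differentiable ℝ P := hP.differentiable (by simp)
  have hQd : Differentiable ℝ Q := hQ.differentiable (by simp)
  have hω_fderiv (x v w : Fin 2 → ℝ) :
      fderiv ℝ ω x v w = fderiv ℝ P x v * w 0 + fderiv ℝ Q x v * w 1 := by
    have h := ((hPd x).hasFDerivAt.smul_const (π 0)).add ((hQd x).hasFDerivAt.smul_const (π 1))
    have h' : fderiv ℝ ω x = _ := h.fderiv
    simp [h', π]
  have fderiv_eq {f : (Fin 2 → ℝ) → ℝ} (x v : Fin 2 → ℝ) :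
      fderiv ℝ f x v = v 0 * dx f x + v 1 * dy f x := by
    conv_lhs => rw [pi_eq_sum_univ' v]
    simp [dx, dy, Fin.sum_univ_two]
  obtain ⟨g, hg⟩ := convex_univ.exists_forall_hasFDerivAt_of_fderiv_symmetric isOpen_univ
    (hω.differentiable (by simp)).differentiableOn fun x _ v w ↦ by
      simp only [hω_fderiv, fderiv_eq, hPQ]
      ring
  have hg' (x : Fin 2 → ℝ) : HasFDerivAt g (ω x) x := hg x (Set.mem_univ x)
  have hfderiv : fderiv ℝ g = ω := funext fun x ↦ (hg' x).fderiv
  refine ⟨g, ?_, ?_, ?_⟩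
  · exact contDiff_infty_iff_fderiv.2 ⟨fun x ↦ (hg' x).differentiableAt, hfderiv ▸ hω⟩
  · ext x
    simp [dx, hfderiv, ω, π]
  · ext x
    simp [dy, hfderiv, ω, π]

theorem fderiv_exp_mul_apply {E : Type*} [NormedAddCommGroup E] [NormedSpace ℝ E]
    {g u : E → ℝ} {x : E} (hg : DifferentiableAt ℝ g x) (hu : DifferentiableAt ℝ u x) (v : E) :
    fderiv ℝ (fun y ↦ Real.exp (g y) * u y) x v =
      Real.exp (g x) * (fderiv ℝ u x v + fderiv ℝ g x v * u x) := by
  rw [fderiv_fun_mul hg.exp hu, fderiv_exp hg]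
  simp
  ring

theorem contDiff_dy {f : (Fin 2 → ℝ) → ℝ} (hf : ContDiff ℝ (⊤ : ℕ∞) f) :
    ContDiff ℝ (⊤ : ℕ∞) (dy f) :=
  (contDiff_infty_iff_fderiv.1 hf).2.clm_apply contDiff_const

theorem laplace_invariants_complete
    (a b c a' b' c' : (Fin 2 → ℝ) → ℝ)
    (ha : ContDiff ℝ (⊤ : ℕ∞) a) (hb : ContDiff ℝ (⊤ : ℕ∞) b) (hc : ContDiff ℝ (⊤ : ℕ∞) c)
    (ha' : ContDiff ℝ (⊤ : ℕ∞) a') (hb' : ContDiff ℝ (⊤ : ℕ∞) b') (hc' : ContDiff ℝ (⊤ : ℕ∞) c')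
    (hinv1 : ∀ x, c' x - dx a' x - a' x * b' x = c x - dx a x - a x * b x)
    (hinv2 : ∀ x, c' x - dy b' x - a' x * b' x = c x - dy b x - a x * b x) :
    ∃ g : (Fin 2 → ℝ) → ℝ, ContDiff ℝ (⊤ : ℕ∞) g ∧
      ∀ u : (Fin 2 → ℝ) → ℝ, ContDiff ℝ (⊤ : ℕ∞) u → ∀ x,
        dx (dy u) x + a' x * dx u x + b' x * dy u x + c' x * u x =
        Real.exp (-(g x)) *
          (dx (dy (fun y => Real.exp (g y) * u y)) x
            + a x * dx (fun y => Real.exp (g y) * u y) x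
            + b x * dy (fun y => Real.exp (g y) * u y) x
            + c x * (Real.exp (g x) * u x)) := by
  obtain ⟨g, hg, hgx, hgy⟩ := exists_contDiff_dx_eq_dy_eq (hb'.sub hb) (ha'.sub ha) fun x ↦ by
    have hdy : dy (fun y ↦ b' y - b y) x = dy b' x - dy b x := by
      simp [dy, fderiv_fun_sub (hb'.differentiable (by simp) x) (hb.differentiable (by simp) x)]
    have hdx : dx (fun y ↦ a' y - a y) x = dx a' x - dx a x := by
      simp [dx, fderiv_fun_sub (ha'.differentiable (by simp) x) (ha.differentiable (by simp) x)]
    rw [hdy, hdx]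
    linarith [hinv1 x, hinv2 x]
  refine ⟨g, hg, fun u hu x ↦ ?_⟩
  have hgd : Differentiable ℝ g := hg.differentiable (by simp)
  have hud : Differentiable ℝ u := hu.differentiable (by simp)
  have hdyu : Differentiable ℝ (dy u) := (contDiff_dy hu).differentiable (by simp)
  have hdyg : Differentiable ℝ (dy g) := (contDiff_dy hg).differentiable (by simp)
  have hdx {w : (Fin 2 → ℝ) → ℝ} (hw : Differentiable ℝ w) :
      dx (fun y ↦ Real.exp (g y) * w y) x = Real.exp (g x) * (dx w x + dx g x * w x) :=
    fderiv_exp_mul_apply (hgd x) (hw x) _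
  have hdy : dy (fun y ↦ Real.exp (g y) * u y) =
      fun y ↦ Real.exp (g y) * (dy u y + dy g y * u y) :=
    funext fun y ↦ fderiv_exp_mul_apply (hgd y) (hud y) _
  have hdxdy : dx (fun y ↦ dy u y + dy g y * u y) x =
      dx (dy u) x + (dy g x * dx u x + u x * dx (dy g) x) := by
    rw [dx, fderiv_fun_add (hdyu x) ((hdyg x).fun_mul (hud x)), fderiv_fun_mul (hdyg x) (hud x)]
    rfl
  have hdxdyg : dx (dy g) x = dx a' x - dx a x := by
    rw [hgy]
    simp [dx, fderiv_fun_sub (ha'.differentiable (by simp) x) (ha.differentiable (by simp) x)]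
  rw [hdy, hdx (hdyu.fun_add (hdyg.fun_mul hud)), hdx hud, hdxdy, hdxdyg, hgx, hgy, Real.exp_neg]
  field_simp
  linear_combination u x * hinv1 x
end

section
/- Let a20, a11, a02, a10, a01, a00 and a20', a11', a02', a10', a01', a00' and g be smooth real functions on ℝ², and define L u = ∂_x∂_x∂_y u + ∂_x∂_y∂_y u + a20·∂_x∂_x u + a11·∂_x∂_y u + a02·∂_y∂_y u + a10·∂_x u + a01·∂_y u + a00·u, and L' analogously with the primed coefficients. If L' u = e^{−g}·L(e^{g}·u) for every smooth u : ℝ² → ℝ, then the compatibility invariant agrees: ∂_x a20' − ∂_y a02' = ∂_x a20 − ∂_y a02. -/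
/-- The derivative of `f` in the fixed direction `v`. -/
noncomputable def dirDeriv (v : Fin 2 → ℝ) (f : (Fin 2 → ℝ) → ℝ) : (Fin 2 → ℝ) → ℝ :=
  fun p => fderiv ℝ f p v

theorem dx_eq_dirDeriv : dx = dirDeriv (Pi.single 0 1) := rfl

theorem dy_eq_dirDeriv : dy = dirDeriv (Pi.single 1 1) := rfl

section dirDeriv

variable {f u : (Fin 2 → ℝ) → ℝ} {a b c v w x : Fin 2 → ℝ}

theorem ContDiff.dirDeriv (hf : ContDiff ℝ (⊤ : ℕ∞) f) (v : Fin 2 → ℝ) :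
    ContDiff ℝ (⊤ : ℕ∞) (dirDeriv v f) :=
  (hf.fderiv_right (m := (⊤ : ℕ∞)) (by simp)).clm_apply contDiff_const

theorem ContDiff.differentiable_of_smooth (hf : ContDiff ℝ (⊤ : ℕ∞) f) : Differentiable ℝ f :=
  hf.differentiable (by simp)

theorem dirDeriv_add (hf : ContDiff ℝ (⊤ : ℕ∞) f) (hu : ContDiff ℝ (⊤ : ℕ∞) u) :
    dirDeriv v (fun y => f y + u y) = fun y => dirDeriv v f y + dirDeriv v u y := by
  funext y
  simp [dirDeriv, fderiv_fun_add (hf.differentiable_of_smooth y) (hu.differentiable_of_smooth y)]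

theorem dirDeriv_mul (hf : ContDiff ℝ (⊤ : ℕ∞) f) (hu : ContDiff ℝ (⊤ : ℕ∞) u) :
    dirDeriv v (fun y => f y * u y) = fun y => dirDeriv v f y * u y + f y * dirDeriv v u y := by
  funext y
  simp only [dirDeriv,
    fderiv_fun_mul (hf.differentiable_of_smooth y) (hu.differentiable_of_smooth y),
    _root_.add_apply, _root_.smul_apply, smul_eq_mul]
  ring

theorem dirDeriv_exp (hf : ContDiff ℝ (⊤ : ℕ∞) f) :
    dirDeriv v (fun y => Real.exp (f y)) x = Real.exp (f x) * dirDeriv v f x := by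
  simp [dirDeriv, fderiv_exp (hf.differentiable_of_smooth x)]

theorem dirDeriv_comm (hf : ContDiff ℝ (⊤ : ℕ∞) f) :
    dirDeriv v (dirDeriv w f) x = dirDeriv w (dirDeriv v f) x := by
  have hd : DifferentiableAt ℝ (fderiv ℝ f) x :=
    (hf.fderiv_right (m := (⊤ : ℕ∞)) (by simp)).differentiable (by simp) x
  have hs : IsSymmSndFDerivAt ℝ f x := hf.contDiffAt.isSymmSndFDerivAt <| by
    simpa using WithTop.coe_le_coe.2 (le_top : (2 : ℕ∞) ≤ ⊤)
  have key (v w : Fin 2 → ℝ) :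
      dirDeriv v (dirDeriv w f) x = fderiv ℝ (fderiv ℝ f) x v w := by
    change fderiv ℝ (fun p => fderiv ℝ f p w) x v = _
    simp [fderiv_clm_apply hd (differentiableAt_const w)]
  rw [key, key, hs v w]

theorem dirDeriv_dirDeriv_mul (hf : ContDiff ℝ (⊤ : ℕ∞) f) (hu : ContDiff ℝ (⊤ : ℕ∞) u) :
    dirDeriv a (dirDeriv b (fun y => f y * u y)) = fun y =>
      (dirDeriv a (dirDeriv b f) y * u y + dirDeriv b f y * dirDeriv a u y) +
        (dirDeriv a f y * dirDeriv b u y + f y * dirDeriv a (dirDeriv b u) y) := by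
  rw [dirDeriv_mul hf hu, dirDeriv_add ((hf.dirDeriv b).mul hu) (hf.mul (hu.dirDeriv b)),
    dirDeriv_mul (hf.dirDeriv b) hu, dirDeriv_mul hf (hu.dirDeriv b)]

/-- The third-order Leibniz rule at a point where `u` vanishes together with its gradient. -/
theorem dirDeriv_dirDeriv_dirDeriv_mul (hf : ContDiff ℝ (⊤ : ℕ∞) f)
    (hu : ContDiff ℝ (⊤ : ℕ∞) u) (h0 : u x = 0) (h1 : ∀ v, dirDeriv v u x = 0) :
    dirDeriv a (dirDeriv b (dirDeriv c (fun y => f y * u y))) x =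
      dirDeriv a f x * dirDeriv b (dirDeriv c u) x +
        dirDeriv b f x * dirDeriv a (dirDeriv c u) x +
        dirDeriv c f x * dirDeriv a (dirDeriv b u) x +
        f x * dirDeriv a (dirDeriv b (dirDeriv c u)) x := by
  rw [dirDeriv_mul hf hu, dirDeriv_add ((hf.dirDeriv c).mul hu) (hf.mul (hu.dirDeriv c)),
    dirDeriv_add (((hf.dirDeriv c).mul hu).dirDeriv b) ((hf.mul (hu.dirDeriv c)).dirDeriv b),
    dirDeriv_dirDeriv_mul (hf.dirDeriv c) hu, dirDeriv_dirDeriv_mul hf (hu.dirDeriv c)]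
  simp only [h0, h1]
  ring

theorem contDiff_sq_coord_sub (i : Fin 2) (p : Fin 2 → ℝ) :
    ContDiff ℝ (⊤ : ℕ∞) (fun y : Fin 2 → ℝ => (y i - p i) ^ 2) := by
  fun_prop

theorem dirDeriv_sq_coord_sub (i : Fin 2) (p : Fin 2 → ℝ) :
    dirDeriv v (fun y => (y i - p i) ^ 2) = fun y => 2 * v i * (y i - p i) := by
  funext y
  have h := (((hasFDerivAt_apply (𝕜 := ℝ) i y).sub_const (p i)).pow 2).fderiv
  simp only [dirDeriv]
  rw [h]
  simp
  ring

theorem dirDeriv_mul_coord_sub (i : Fin 2) (p : Fin 2 → ℝ) (r : ℝ) :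
    dirDeriv v (fun y => r * (y i - p i)) = fun _ => r * v i := by
  funext y
  have h := (((hasFDerivAt_apply (𝕜 := ℝ) i y).sub_const (p i)).const_mul r).fderiv
  simp only [dirDeriv]
  rw [h]
  simp

theorem dirDeriv_const (r : ℝ) : dirDeriv v (fun _ => r) = fun _ => 0 := by
  funext y
  simp [dirDeriv]

end dirDeriv

theorem compatibility_invariant_xxy_xyy
    (a20 a11 a02 a10 a01 a00 a20' a11' a02' a10' a01' a00' g : (Fin 2 → ℝ) → ℝ)
    (h20 : ContDiff ℝ (⊤ : ℕ∞) a20) (h11 : ContDiff ℝ (⊤ : ℕ∞) a11) (h02 : ContDiff ℝ (⊤ : ℕ∞) a02)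
    (h10 : ContDiff ℝ (⊤ : ℕ∞) a10) (h01 : ContDiff ℝ (⊤ : ℕ∞) a01) (h00 : ContDiff ℝ (⊤ : ℕ∞) a00)
    (h20' : ContDiff ℝ (⊤ : ℕ∞) a20') (h11' : ContDiff ℝ (⊤ : ℕ∞) a11') (h02' : ContDiff ℝ (⊤ : ℕ∞) a02')
    (h10' : ContDiff ℝ (⊤ : ℕ∞) a10') (h01' : ContDiff ℝ (⊤ : ℕ∞) a01') (h00' : ContDiff ℝ (⊤ : ℕ∞) a00')
    (hg : ContDiff ℝ (⊤ : ℕ∞) g)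
    (hgauge : ∀ u : (Fin 2 → ℝ) → ℝ, ContDiff ℝ (⊤ : ℕ∞) u → ∀ x,
      dx (dx (dy u)) x + dx (dy (dy u)) x + a20' x * dx (dx u) x
        + a11' x * dx (dy u) x + a02' x * dy (dy u) x
        + a10' x * dx u x + a01' x * dy u x + a00' x * u x =
      Real.exp (-(g x)) *
        (dx (dx (dy (fun y => Real.exp (g y) * u y))) x
          + dx (dy (dy (fun y => Real.exp (g y) * u y))) x
          + a20 x * dx (dx (fun y => Real.exp (g y) * u y)) x
          + a11 x * dx (dy (fun y => Real.exp (g y) * u y)) x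
          + a02 x * dy (dy (fun y => Real.exp (g y) * u y)) x
          + a10 x * dx (fun y => Real.exp (g y) * u y) x
          + a01 x * dy (fun y => Real.exp (g y) * u y) x
          + a00 x * (Real.exp (g x) * u x))) :
    ∀ x, dx a20' x - dy a02' x = dx a20 x - dy a02 x := by
  rw [dx_eq_dirDeriv, dy_eq_dirDeriv] at *
  have hE : ContDiff ℝ (⊤ : ℕ∞) (fun y => Real.exp (g y)) := hg.exp
  have test (i : Fin 2) (x : Fin 2 → ℝ) := by
    have hu := contDiff_sq_coord_sub i x
    have h0 : (fun y : Fin 2 → ℝ => (y i - x i) ^ 2) x = 0 := by simp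
    have h1 (v) : dirDeriv v (fun y : Fin 2 → ℝ => (y i - x i) ^ 2) x = 0 := by
      simp [dirDeriv_sq_coord_sub]
    have h := hgauge _ hu x
    simp only [dirDeriv_dirDeriv_dirDeriv_mul hE hu h0 h1] at h
    simp only [dirDeriv_dirDeriv_mul hE hu] at h
    simp only [dirDeriv_mul hE hu, dirDeriv_exp hg] at h
    simp only [dirDeriv_sq_coord_sub, dirDeriv_mul_coord_sub, dirDeriv_const] at h
    exact h
  have e20 : a20' = fun x => a20 x + dirDeriv (Pi.single 1 1) g x := by
    funext x
    have h := test 0 x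
    simp [Real.exp_neg] at h
    field_simp at h
    linarith
  have e02 : a02' = fun x => a02 x + dirDeriv (Pi.single 0 1) g x := by
    funext x
    have h := test 1 x
    simp [Real.exp_neg] at h
    field_simp at h
    linarith
  intro x
  rw [e20, e02, dirDeriv_add h20 (hg.dirDeriv _), dirDeriv_add h02 (hg.dirDeriv _)]
  linarith [dirDeriv_comm (v := Pi.single 0 1) (w := Pi.single 1 1) (x := x) hg]
end
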